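/- Let D be a nonempty closed convex bounded subset of a uniformly convex Banach space X, let t : D → D be a single-valued mapping and T : D → KC(D) a multivalued mapping, both satisfying conditions (E) and (C_λ) for some λ ∈ (0,1), and suppose t and T commute. Then there exists a point z ∈ D such that z = t(z) ∈ T(z). -/

import Mathlib

open Filter Topology

section KrasnoselskiiIteration

variable {X : Type*} [NormedAddCommGroup X] [NormedSpace ℝ X] {l : ℝ} {x y : ℕ → X}

lemma krasnoselskii_norm_step (hl : l ∈ Set.Ioo (0 : ℝ) 1)
    (hx : ∀ n, x (n + 1) = (1 - l) • x n + l • y n) (n : ℕ) :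
    ‖x (n + 1) - x n‖ = l * ‖y n - x n‖ := by
  have h : x (n + 1) - x n = l • (y n - x n) := by rw [hx]; module
  rw [h, norm_smul, Real.norm_of_nonneg hl.1.le]

lemma krasnoselskii_antitone (hl : l ∈ Set.Ioo (0 : ℝ) 1)
    (hx : ∀ n, x (n + 1) = (1 - l) • x n + l • y n)
    (hy : ∀ n, ‖y (n + 1) - y n‖ ≤ ‖x (n + 1) - x n‖) :
    Antitone fun n => ‖y n - x n‖ := by
  refine antitone_nat_of_succ_le fun n => ?_
  have h1 : y (n + 1) - x (n + 1) = (y (n + 1) - y n) + (1 - l) • (y n - x n) := by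
    rw [hx]; module
  have h2 := hy n
  rw [krasnoselskii_norm_step hl hx] at h2
  calc ‖y (n + 1) - x (n + 1)‖ ≤ ‖y (n + 1) - y n‖ + ‖(1 - l) • (y n - x n)‖ := by
        rw [h1]; exact norm_add_le _ _
    _ = ‖y (n + 1) - y n‖ + (1 - l) * ‖y n - x n‖ := by
        rw [norm_smul, Real.norm_of_nonneg (sub_nonneg.2 hl.2.le)]
    _ ≤ ‖y n - x n‖ := by linarith

lemma krasnoselskii_norm_sub_le (hl : l ∈ Set.Ioo (0 : ℝ) 1)
    (hx : ∀ n, x (n + 1) = (1 - l) • x n + l • y n)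
    (hy : ∀ n, ‖y (n + 1) - y n‖ ≤ ‖x (n + 1) - x n‖) (i n : ℕ) :
    ‖y (i + n) - y i‖ ≤ n * (l * ‖y i - x i‖) := by
  induction n with
  | zero => simp
  | succ n ih =>
    have h2 := hy (i + n)
    rw [krasnoselskii_norm_step hl hx] at h2
    have h3 : ‖y (i + n) - x (i + n)‖ ≤ ‖y i - x i‖ :=
      krasnoselskii_antitone hl hx hy (Nat.le_add_right i n)
    have h4 := mul_le_mul_of_nonneg_left h3 hl.1.le
    have h5 := norm_sub_le_norm_sub_add_norm_sub (y (i + n + 1)) (y (i + n)) (y i)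
    push_cast
    rw [← add_assoc]
    linarith

/-- The Goebel–Kirk inequality. -/
lemma goebel_kirk_inequality (hl : l ∈ Set.Ioo (0 : ℝ) 1)
    (hx : ∀ n, x (n + 1) = (1 - l) • x n + l • y n)
    (hy : ∀ n, ‖y (n + 1) - y n‖ ≤ ‖x (n + 1) - x n‖) (n i : ℕ) :
    (1 + n * l) * ‖y i - x i‖ ≤
      ‖y (i + n) - x i‖ + ((1 - l)⁻¹) ^ n * (‖y i - x i‖ - ‖y (i + n) - x (i + n)‖) := by
  have hl' : 0 < 1 - l := sub_pos.2 hl.2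
  induction n generalizing i with
  | zero => simp
  | succ n ih =>
    have h1 := ih (i + 1)
    have hidx : i + 1 + n = i + (n + 1) := by ring
    rw [hidx] at h1
    have hanti : ‖y (i + 1) - x (i + 1)‖ ≤ ‖y i - x i‖ :=
      krasnoselskii_antitone hl hx hy (Nat.le_succ i)
    have h2 := krasnoselskii_norm_sub_le hl hx hy i (n + 1)
    have h3 : ‖y (i + (n + 1)) - x (i + 1)‖ ≤
        (1 - l) * ‖y (i + (n + 1)) - x i‖ + l * ‖y (i + (n + 1)) - y i‖ := by
      have h : y (i + (n + 1)) - x (i + 1) =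
          (1 - l) • (y (i + (n + 1)) - x i) + l • (y (i + (n + 1)) - y i) := by
        rw [hx]; module
      rw [h]
      refine (norm_add_le _ _).trans_eq ?_
      rw [norm_smul, norm_smul, Real.norm_of_nonneg hl'.le, Real.norm_of_nonneg hl.1.le]
    have hpow : 1 + n * l ≤ ((1 - l)⁻¹) ^ n := by
      have hinv : 1 + l ≤ (1 - l)⁻¹ := by
        rw [← one_div, le_div_iff₀ hl']
        nlinarith [sq_nonneg l]
      exact (one_add_mul_le_pow (by linarith [hl.1]) n).trans
        (pow_le_pow_left₀ (by linarith [hl.1]) hinv n)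
    have h4 := mul_le_mul_of_nonneg_right hpow (sub_nonneg.2 hanti)
    have h5 := mul_le_mul_of_nonneg_left h2 hl.1.le
    refine le_of_mul_le_mul_left ?_ hl'
    have h6 : (1 - l) * (‖y (i + (n + 1)) - x i‖ + ((1 - l)⁻¹) ^ (n + 1) *
          (‖y i - x i‖ - ‖y (i + (n + 1)) - x (i + (n + 1))‖)) =
        (1 - l) * ‖y (i + (n + 1)) - x i‖ + ((1 - l)⁻¹) ^ n *
          (‖y i - x i‖ - ‖y (i + (n + 1)) - x (i + (n + 1))‖) := by
      rw [pow_succ]; field_simp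
    rw [h6]
    push_cast at h5 ⊢
    nlinarith

lemma krasnoselskii_tendsto_zero (hl : l ∈ Set.Ioo (0 : ℝ) 1)
    (hx : ∀ n, x (n + 1) = (1 - l) • x n + l • y n)
    (hy : ∀ n, ‖y (n + 1) - y n‖ ≤ ‖x (n + 1) - x n‖)
    {M : ℝ} (hM : ∀ m n, ‖y m - x n‖ ≤ M) :
    Tendsto (fun n => ‖y n - x n‖) atTop (𝓝 0) := by
  have hanti := krasnoselskii_antitone hl hx hy
  have hlim := tendsto_atTop_ciInf hanti ⟨0, by rintro _ ⟨n, rfl⟩; exact norm_nonneg _⟩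
  set r := ⨅ n, ‖y n - x n‖
  have hr : 0 ≤ r := le_ciInf fun n => norm_nonneg _
  have hbound (n : ℕ) : (1 + n * l) * r ≤ M := by
    have hshift : Tendsto (fun i => ‖y (i + n) - x (i + n)‖) atTop (𝓝 r) :=
      hlim.comp (tendsto_add_atTop_nat n)
    have h1 := ((hlim.sub hshift).const_mul (((1 - l)⁻¹) ^ n)).const_add M
    rw [sub_self, mul_zero, add_zero] at h1
    refine le_of_tendsto_of_tendsto' (hlim.const_mul (1 + n * l)) h1 fun i => ?_
    exact (goebel_kirk_inequality hl hx hy n i).trans (by gcongr; exact hM _ _)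
  have hr0 : r = 0 := by
    by_contra hne
    have hpos : 0 < l * r := mul_pos hl.1 (lt_of_le_of_ne hr (Ne.symm hne))
    obtain ⟨n, hn⟩ := exists_nat_gt (M / (l * r))
    rw [div_lt_iff₀ hpos] at hn
    nlinarith [hbound n]
  rwa [hr0] at hlim

end KrasnoselskiiIteration

section AsymptoticCenter

variable {X : Type*} [NormedAddCommGroup X] [NormedSpace ℝ X] [UniformConvexSpace X]

lemma exists_norm_half_add_le_sub {d ε : ℝ} (hd : 0 ≤ d) (hε : 0 < ε) :
    ∃ η > 0, ∀ x y : X, ‖x‖ ≤ d + η → ‖y‖ ≤ d + η → ε ≤ ‖x - y‖ →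
      ‖(1 / 2 : ℝ) • (x + y)‖ ≤ d - η := by
  obtain rfl | hd := hd.eq_or_lt
  · refine ⟨ε / 4, by positivity, fun x y hx hy h => ?_⟩
    linarith [norm_sub_le x y]
  obtain ⟨δ, hδ, h⟩ := exists_forall_closed_ball_dist_add_le_two_sub X
    (show 0 < ε / (d + 1) by positivity)
  refine ⟨min 1 (d * δ / 4), by positivity, fun x y hx hy hxy => ?_⟩
  set η := min 1 (d * δ / 4)
  have hη : 0 < η := by positivity
  have hη1 : η ≤ 1 := min_le_left _ _
  have hη2 : η ≤ d * δ / 4 := min_le_right _ _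
  have hR : 0 < d + η := by positivity
  have hnorm (v : X) : ‖(d + η)⁻¹ • v‖ = ‖v‖ / (d + η) := by
    rw [norm_smul, norm_inv, Real.norm_of_nonneg hR.le, div_eq_inv_mul]
  have h1 := @h ((d + η)⁻¹ • x) (by rw [hnorm, div_le_one hR]; exact hx)
    ((d + η)⁻¹ • y) (by rw [hnorm, div_le_one hR]; exact hy)
    (by rw [← smul_sub, hnorm]; gcongr)
  rw [← smul_add, hnorm, div_le_iff₀ hR] at h1
  rw [norm_smul, Real.norm_of_nonneg (by norm_num)]
  nlinarith

/-- Existence and uniqueness of the asymptotic center along an ultrafilter, phrased through the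
asymptotic radius `r`. -/
lemma exists_unique_asymptotic_center [CompleteSpace X] {ι : Type*} {U : Filter ι} [U.NeBot]
    {x : ι → X} {F : Set X} (hne : F.Nonempty) (hcl : IsClosed F) (hconv : Convex ℝ F)
    {r : X → ℝ} (hr : ∀ y, Tendsto (fun n => ‖x n - y‖) U (𝓝 (r y))) :
    ∃ z ∈ F, ∀ w ∈ F, r w ≤ r z → w = z := by
  have hr0 (y : X) : 0 ≤ r y := ge_of_tendsto' (hr y) fun n => norm_nonneg _
  have hlip (y z : X) : r y ≤ r z + ‖y - z‖ :=
    le_of_tendsto_of_tendsto' (hr y) ((hr z).add_const _) fun n => by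
      have := norm_sub_le_norm_sub_add_norm_sub (x n) z y
      rwa [norm_sub_rev z y] at this
  set d := sInf (r '' F)
  have hbdd : BddBelow (r '' F) := ⟨0, by rintro _ ⟨y, -, rfl⟩; exact hr0 y⟩
  have hd : 0 ≤ d := Real.sInf_nonneg (by rintro _ ⟨y, -, rfl⟩; exact hr0 y)
  have hdle {y : X} (hy : y ∈ F) : d ≤ r y := csInf_le hbdd ⟨y, hy, rfl⟩
  have hclose {ε : ℝ} (hε : 0 < ε) : ∃ η > 0, ∀ y ∈ F, ∀ z ∈ F,
      r y < d + η → r z < d + η → ‖y - z‖ < ε := by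
    obtain ⟨η, hη, h⟩ := exists_norm_half_add_le_sub (X := X) hd hε
    refine ⟨η, hη, fun y hy z hz hry hrz => ?_⟩
    by_contra! hyz
    have hmid : (1 / 2 : ℝ) • y + (1 / 2 : ℝ) • z ∈ F :=
      hconv hy hz (by norm_num) (by norm_num) (by norm_num)
    have hle : r ((1 / 2 : ℝ) • y + (1 / 2 : ℝ) • z) ≤ d - η := by
      refine le_of_tendsto (hr _) ?_
      filter_upwards [(hr y).eventually_le_const hry, (hr z).eventually_le_const hrz]
        with n hny hnz
      have h1 := h (x n - y) (x n - z) hny hnz (by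
        rw [sub_sub_sub_cancel_left, norm_sub_rev]; exact hyz)
      rwa [show (1 / 2 : ℝ) • (x n - y + (x n - z)) =
        x n - ((1 / 2 : ℝ) • y + (1 / 2 : ℝ) • z) by module] at h1
    linarith [hdle hmid]
  have hex (k : ℕ) : ∃ y ∈ F, r y < d + 1 / ((k : ℝ) + 1) := by
    obtain ⟨_, ⟨y, hy, rfl⟩, h⟩ := exists_lt_of_csInf_lt (hne.image r)
      (show d < d + 1 / ((k : ℝ) + 1) by linarith [Nat.one_div_pos_of_nat (α := ℝ) (n := k)])
    exact ⟨y, hy, h⟩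
  choose c hcF hc using hex
  have hcsmall {η : ℝ} (hη : 0 < η) : ∃ N, ∀ k ≥ N, r (c k) < d + η := by
    obtain ⟨N, hN⟩ := exists_nat_one_div_lt hη
    refine ⟨N, fun k hk => ?_⟩
    linarith [hc k, Nat.one_div_le_one_div (α := ℝ) hk]
  have hcauchy : CauchySeq c := by
    refine Metric.cauchySeq_iff.2 fun ε hε => ?_
    obtain ⟨η, hη, h⟩ := hclose hε
    obtain ⟨N, hN⟩ := hcsmall hη
    refine ⟨N, fun m hm n hn => ?_⟩
    rw [dist_eq_norm]
    exact h _ (hcF m) _ (hcF n) (hN m hm) (hN n hn)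
  obtain ⟨z, hz⟩ := cauchySeq_tendsto_of_complete hcauchy
  have hzF : z ∈ F := hcl.mem_of_tendsto hz (Eventually.of_forall hcF)
  have hzd : r z ≤ d := by
    have h1 : Tendsto (fun k : ℕ => d + 1 / ((k : ℝ) + 1) + ‖z - c k‖) atTop
        (𝓝 (d + 0 + ‖z - z‖)) :=
      (tendsto_one_div_add_atTop_nhds_zero_nat.const_add d).add
        (tendsto_const_nhds.sub hz).norm
    rw [sub_self, norm_zero, add_zero, add_zero] at h1
    exact ge_of_tendsto' h1 fun k => by linarith [hlip z (c k), hc k]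
  refine ⟨z, hzF, fun w hw hwz => ?_⟩
  by_contra hwne
  obtain ⟨η, hη, h⟩ := hclose (norm_pos_iff.2 (sub_ne_zero.2 hwne))
  exact lt_irrefl _ (h w hw z hzF (by linarith) (by linarith))

end AsymptoticCenter

section FixedPoint

lemma isClosed_fixedPoints_of_quasinonexpansive {X : Type*} [NormedAddCommGroup X]
    {D : Set X} {t : X → X} (hcl : IsClosed D)
    (hq : ∀ p ∈ D, t p = p → ∀ x ∈ D, ‖p - t x‖ ≤ ‖p - x‖) :
    IsClosed {x | x ∈ D ∧ t x = x} := by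
  refine IsSeqClosed.isClosed fun s x hs hx => ?_
  have hxD : x ∈ D := hcl.mem_of_tendsto hx (Eventually.of_forall fun n => (hs n).1)
  have h1 : ‖x - t x‖ ≤ ‖x - x‖ :=
    le_of_tendsto_of_tendsto' (hx.sub_const _).norm (hx.sub_const _).norm fun n =>
      hq (s n) (hs n).1 (hs n).2 x hxD
  rw [sub_self, norm_zero, norm_le_zero_iff, sub_eq_zero] at h1
  exact ⟨hxD, h1.symm⟩

variable {X : Type*} [NormedAddCommGroup X] [NormedSpace ℝ X] [UniformConvexSpace X]

/-- A multivalued mapping satisfying conditions (E) and `(C_λ)` on `F` has a fixed point in `F` as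
soon as nearest points in its values to points of `F` can be found in `F`. -/
lemma exists_mem_of_nearest_point [CompleteSpace X] {F : Set X} (hne : F.Nonempty)
    (hcl : IsClosed F) (hconv : Convex ℝ F) (hbdd : Bornology.IsBounded F) {T : X → Set X}
    (hTcp : ∀ x ∈ F, IsCompact (T x))
    (hnear : ∀ x ∈ F, ∀ p ∈ F, ∃ u ∈ T x, u ∈ F ∧ ‖p - u‖ ≤ Metric.infDist p (T x))
    {l : ℝ} (hl : l ∈ Set.Ioo (0 : ℝ) 1)
    (hTC : ∀ x ∈ F, ∀ y ∈ F, l * Metric.infDist x (T x) ≤ ‖x - y‖ →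
      Metric.hausdorffDist (T x) (T y) ≤ ‖x - y‖)
    {μ : ℝ} (hμ : 1 ≤ μ) (hTE : ∀ x ∈ F, ∀ y ∈ F,
      Metric.infDist x (T y) ≤ μ * Metric.infDist x (T x) + ‖x - y‖) :
    ∃ z ∈ F, z ∈ T z := by
  choose! u huT huF hu using hnear
  obtain ⟨p, hp⟩ := hne
  let s : ℕ → X × X := fun n => Nat.rec (p, u p p)
    (fun _ q => ((1 - l) • q.1 + l • q.2, u ((1 - l) • q.1 + l • q.2) q.2)) n
  let x : ℕ → X := fun n => (s n).1
  let y : ℕ → X := fun n => (s n).2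
  have hx (n : ℕ) : x (n + 1) = (1 - l) • x n + l • y n := rfl
  have hysucc (n : ℕ) : y (n + 1) = u (x (n + 1)) (y n) := rfl
  have hmem (n : ℕ) : x n ∈ F ∧ y n ∈ F ∧ y n ∈ T (x n) := by
    induction n with
    | zero => exact ⟨hp, huF p hp p hp, huT p hp p hp⟩
    | succ n ih =>
      have h1 : x (n + 1) ∈ F :=
        hconv ih.1 ih.2.1 (sub_nonneg.2 hl.2.le) hl.1.le (sub_add_cancel 1 l)
      rw [hysucc]
      exact ⟨h1, huF _ h1 _ ih.2.1, huT _ h1 _ ih.2.1⟩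
  have hinf (n : ℕ) : Metric.infDist (x n) (T (x n)) ≤ ‖y n - x n‖ := by
    rw [norm_sub_rev, ← dist_eq_norm]
    exact Metric.infDist_le_dist_of_mem (hmem n).2.2
  have hy (n : ℕ) : ‖y (n + 1) - y n‖ ≤ ‖x (n + 1) - x n‖ := by
    have hC := hTC (x n) (hmem n).1 (x (n + 1)) (hmem (n + 1)).1 (by
      rw [norm_sub_rev, krasnoselskii_norm_step hl hx]
      exact mul_le_mul_of_nonneg_left (hinf n) hl.1.le)
    have hfin : Metric.hausdorffEDist (T (x n)) (T (x (n + 1))) ≠ ⊤ :=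
      Metric.hausdorffEDist_ne_top_of_nonempty_of_bounded ⟨_, (hmem n).2.2⟩
        ⟨_, (hmem (n + 1)).2.2⟩ (hTcp _ (hmem n).1).isBounded
        (hTcp _ (hmem (n + 1)).1).isBounded
    have hH := Metric.infDist_le_hausdorffDist_of_mem (hmem n).2.2 hfin
    rw [norm_sub_rev, norm_sub_rev (x (n + 1)), hysucc]
    exact ((hu _ (hmem (n + 1)).1 _ (hmem n).2.1).trans hH).trans hC
  obtain ⟨M, hM⟩ := Metric.isBounded_iff.1 hbdd
  have hzero := krasnoselskii_tendsto_zero hl hx hy (M := M) fun m n => by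
    rw [← dist_eq_norm]; exact hM (hmem m).2.1 (hmem n).1
  have hU : (hyperfilter ℕ : Filter ℕ) ≤ atTop := by
    rw [← Nat.cofinite_eq_atTop]; exact hyperfilter_le_cofinite
  have hlim (w : X) : ∃ r, Tendsto (fun n => ‖x n - w‖) (hyperfilter ℕ) (𝓝 r) := by
    have hmap : ((hyperfilter ℕ).map fun n => ‖x n - w‖ : Filter ℝ) ≤
        𝓟 (Set.Icc 0 (M + ‖p - w‖)) := by
      rw [le_principal_iff]
      refine Ultrafilter.mem_map.2 (Eventually.of_forall fun n => ⟨norm_nonneg _, by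
      have h1 := norm_sub_le_norm_sub_add_norm_sub (x n) p w
      have h2 := hM (hmem n).1 hp
      rw [dist_eq_norm] at h2
      linarith⟩)
    obtain ⟨r, -, hr⟩ := isCompact_Icc.ultrafilter_le_nhds _ hmap
    exact ⟨r, hr⟩
  choose r hr using hlim
  obtain ⟨z, hzF, hz⟩ := exists_unique_asymptotic_center ⟨p, hp⟩ hcl hconv hr
  have hvmem : ((hyperfilter ℕ).map fun n => u z (x n) : Filter X) ≤ 𝓟 (T z) := by
    rw [le_principal_iff]
    exact Ultrafilter.mem_map.2 (Eventually.of_forall fun n => huT z hzF _ (hmem n).1)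
  obtain ⟨w, hwT, hw⟩ := (hTcp z hzF).ultrafilter_le_nhds _ hvmem
  have hw : Tendsto (fun n => u z (x n)) (hyperfilter ℕ) (𝓝 w) := hw
  have hwF : w ∈ F := hcl.mem_of_tendsto hw (Eventually.of_forall fun n => huF z hzF _ (hmem n).1)
  have hrw : r w ≤ r z := by
    have h1 := (((hzero.mono_left hU).const_mul μ).add (hr z)).add
      (hw.sub_const w).norm
    rw [mul_zero, zero_add, sub_self, norm_zero, add_zero] at h1
    refine le_of_tendsto_of_tendsto' (hr w) h1 fun n => ?_
    have h2 := norm_sub_le_norm_sub_add_norm_sub (x n) (u z (x n)) w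
    have h3 := hu z hzF (x n) (hmem n).1
    have h4 := hTE (x n) (hmem n).1 z hzF
    have h5 := mul_le_mul_of_nonneg_left (hinf n) (zero_le_one.trans hμ)
    linarith
  exact ⟨z, hzF, hz w hwF hrw ▸ hwT⟩

variable {D : Set X} {t : X → X}

lemma convex_fixedPoints_of_quasinonexpansive (hconv : Convex ℝ D)
    (hq : ∀ p ∈ D, t p = p → ∀ x ∈ D, ‖p - t x‖ ≤ ‖p - x‖) :
    Convex ℝ {x | x ∈ D ∧ t x = x} := by
  rintro p ⟨hpD, hp⟩ q ⟨hqD, hqt⟩ a b ha hb hab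
  have hm : a • p + b • q ∈ D := hconv hpD hqD ha hb hab
  refine ⟨hm, ?_⟩
  obtain rfl : a = 1 - b := by linarith
  set m := (1 - b) • p + b • q
  have h1 := hq p hpD hp m hm
  have h2 := hq q hqD hqt m hm
  have e1 : ‖p - m‖ = b * ‖p - q‖ := by
    rw [show p - m = b • (p - q) by simp only [m]; module, norm_smul, Real.norm_of_nonneg hb]
  have e2 : ‖q - m‖ = (1 - b) * ‖p - q‖ := by
    rw [show q - m = (1 - b) • (q - p) by simp only [m]; module, norm_smul,
      Real.norm_of_nonneg ha, norm_sub_rev]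
  have h3 := norm_sub_le_norm_sub_add_norm_sub p (t m) q
  rw [norm_sub_rev (t m) q] at h3
  have h4 : t m = AffineMap.lineMap p q b := by
    apply eq_lineMap_of_dist_eq_mul_of_dist_eq_mul
    · rw [dist_eq_norm, dist_eq_norm]; linarith
    · rw [dist_eq_norm, dist_eq_norm, norm_sub_rev (t m)]; linarith
  rw [h4, AffineMap.lineMap_apply_module]

/-- A nearest point in a compact convex set `K` to a fixed point of a quasi-nonexpansive mapping
leaving `K` invariant is itself fixed. -/
lemma exists_fixed_nearest_point {K : Set X} (hK : IsCompact K) (hKne : K.Nonempty)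
    (hKconv : Convex ℝ K) (hKt : Set.MapsTo t K K) {p : X}
    (hp : ∀ x ∈ K, ‖p - t x‖ ≤ ‖p - x‖) :
    ∃ u ∈ K, t u = u ∧ ‖p - u‖ ≤ Metric.infDist p K := by
  obtain ⟨u, huK, hu⟩ := hK.exists_infDist_eq_dist hKne p
  rw [dist_eq_norm] at hu
  refine ⟨u, huK, ?_, hu.ge⟩
  by_contra hne
  have hlt := norm_combo_lt_of_ne (hp u huK) le_rfl
    (fun h => hne (sub_right_injective h)) (show (0 : ℝ) < 1 / 2 by norm_num)
    (show (0 : ℝ) < 1 / 2 by norm_num) (by norm_num)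
  have hmid : (1 / 2 : ℝ) • t u + (1 / 2 : ℝ) • u ∈ K :=
    hKconv (hKt huK) huK (by norm_num) (by norm_num) (by norm_num)
  have hle := Metric.infDist_le_dist_of_mem (x := p) hmid
  rw [hu, dist_eq_norm, show p - ((1 / 2 : ℝ) • t u + (1 / 2 : ℝ) • u) =
    (1 / 2 : ℝ) • (p - t u) + (1 / 2 : ℝ) • (p - u) by module] at hle
  exact hle.not_gt hlt

end FixedPoint

/-- Theorem 3.6: Let `D` be a nonempty closed convex bounded subset of a
uniformly convex Banach space, `t : D → D` a single-valued mapping and `T : D → KC(D)`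
a multivalued mapping, both satisfying conditions (E) and `(C_λ)` for some `λ ∈ (0,1)`,
which commute. Then there exists `z ∈ D` with `z = t(z) ∈ T(z)`. -/
theorem common_fixed_point_uniformly_convex {X : Type*} [NormedAddCommGroup X]
    [NormedSpace ℝ X] [CompleteSpace X] [UniformConvexSpace X]
    (D : Set X) (hne : D.Nonempty) (hcl : IsClosed D) (hconv : Convex ℝ D)
    (hbdd : Bornology.IsBounded D)
    (t : X → X) (ht : Set.MapsTo t D D)
    (T : X → Set X)
    (hTne : ∀ x ∈ D, (T x).Nonempty) (hTcp : ∀ x ∈ D, IsCompact (T x))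
    (hTconv : ∀ x ∈ D, Convex ℝ (T x)) (hTsub : ∀ x ∈ D, T x ⊆ D)
    (l : ℝ) (hl : l ∈ Set.Ioo (0:ℝ) 1)
    (htC : ∀ x ∈ D, ∀ y ∈ D, l * ‖x - t x‖ ≤ ‖x - y‖ → ‖t x - t y‖ ≤ ‖x - y‖)
    (htE : ∃ μ : ℝ, 1 ≤ μ ∧ ∀ x ∈ D, ∀ y ∈ D, ‖x - t y‖ ≤ μ * ‖x - t x‖ + ‖x - y‖)
    (hTC : ∀ x ∈ D, ∀ y ∈ D, l * Metric.infDist x (T x) ≤ ‖x - y‖ →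
      Metric.hausdorffDist (T x) (T y) ≤ ‖x - y‖)
    (hTE : ∃ μ : ℝ, 1 ≤ μ ∧ ∀ x ∈ D, ∀ y ∈ D,
      Metric.infDist x (T y) ≤ μ * Metric.infDist x (T x) + ‖x - y‖)
    (hcomm : ∀ x ∈ D, ∀ y ∈ D, x ∈ T y → t y ∈ D → t x ∈ T (t y)) :
    ∃ z ∈ D, t z = z ∧ z ∈ T z := by
  have hq : ∀ p ∈ D, t p = p → ∀ x ∈ D, ‖p - t x‖ ≤ ‖p - x‖ := fun p hp hpt x hx => by
    have h := htC p hp x hx (by rw [hpt, sub_self, norm_zero, mul_zero]; exact norm_nonneg _)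
    rwa [hpt] at h
  obtain ⟨μ, hμ, hE⟩ := htE
  obtain ⟨ν, hν, hE'⟩ := hTE
  obtain ⟨p, hpD, hp⟩ : ∃ z ∈ D, z ∈ ({t z} : Set X) :=
    exists_mem_of_nearest_point (T := fun x => {t x}) hne hcl hconv hbdd
      (fun _ _ => isCompact_singleton)
      (fun x hx p _ => ⟨t x, rfl, ht hx, by rw [Metric.infDist_singleton, dist_eq_norm]⟩) hl
      (fun x hx y hy h => by
        rw [Metric.infDist_singleton, dist_eq_norm] at h
        rw [Metric.hausdorffDist_singleton, dist_eq_norm]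
        exact htC x hx y hy h)
      hμ (fun x hx y hy => by
        simp only [Metric.infDist_singleton, dist_eq_norm]
        exact hE x hx y hy)
  have hsub : {x | x ∈ D ∧ t x = x} ⊆ D := fun x hx => hx.1
  obtain ⟨z, hz, hzT⟩ := exists_mem_of_nearest_point (F := {x | x ∈ D ∧ t x = x})
    ⟨p, hpD, hp.symm⟩
    (isClosed_fixedPoints_of_quasinonexpansive hcl hq)
    (convex_fixedPoints_of_quasinonexpansive hconv hq) (hbdd.subset hsub)
    (fun x hx => hTcp x hx.1)
    (fun x hx p hp => by
      obtain ⟨u, huT, hut, hu⟩ := exists_fixed_nearest_point (hTcp x hx.1) (hTne x hx.1)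
        (hTconv x hx.1) (t := t) (p := p)
        (fun v hv => by
          have h := hcomm v (hTsub x hx.1 hv) x hx.1 hv (ht hx.1)
          rwa [hx.2] at h)
        (fun v hv => hq p hp.1 hp.2 v (hTsub x hx.1 hv))
      exact ⟨u, huT, ⟨hTsub x hx.1 huT, hut⟩, hu⟩)
    hl (fun x hx y hy => hTC x hx.1 y hy.1) hν (fun x hx y hy => hE' x hx.1 y hy.1)
  exact ⟨z, hz.1, hz.2, hzT⟩
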